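/- Let K be a simplicial complex on the vertex set [m] with two pure fillings {M_1,…,M_r} and {N_1,…,N_r}, where every M_i and every N_j has the same cardinality n + 1. Then for each i = 1,…,r there exist integers a_1,…,a_r and a finitely supported ℤ-linear combination c of (n+1)-element faces of K such that ∂N_i = a_1 ∂M_1 + ⋯ + a_r ∂M_r + ∂c in the free ℤ-module on the finite subsets of [m], where ∂ is extended linearly. -/

import Mathlib

/-- The `i`-th standard basis vector of `ℝ^m`. -/
def stdBasisVec (m : ℕ) (i : Fin m) : Fin m → ℝ := fun j => if j = i then 1 else 0

/-- The geometric realization of a collection of finite subsets of `[m]`: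
the union of the convex hulls of the corresponding sets of standard basis vectors. -/
def realization {m : ℕ} (K : Set (Finset (Fin m))) : Set (Fin m → ℝ) :=
  ⋃ σ ∈ K, convexHull ℝ (stdBasisVec m '' (σ : Set (Fin m)))

/-- `K` is an (abstract) simplicial complex on the vertex set `[m]`: a collection of
nonempty subsets closed under passing to nonempty subsets and containing all singletons. -/
def IsComplex {m : ℕ} (K : Set (Finset (Fin m))) : Prop :=
  (∀ σ ∈ K, σ.Nonempty) ∧
  (∀ σ ∈ K, ∀ τ : Finset (Fin m), τ ⊆ σ → τ.Nonempty → τ ∈ K) ∧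
  (∀ i : Fin m, {i} ∈ K)

/-- `M` is a minimal non-face of `K`. -/
def IsMinNonFace {m : ℕ} (K : Set (Finset (Fin m))) (M : Finset (Fin m)) : Prop :=
  2 ≤ M.card ∧ M ∉ K ∧ ∀ v ∈ M, M.erase v ∈ K

/-- A finite set `F` of (pairwise distinct) minimal non-faces of `K` is a filling
if the realization of `K` with the members of `F` added as faces is contractible. -/
def IsFilling {m : ℕ} (K : Set (Finset (Fin m))) (F : Finset (Finset (Fin m))) : Prop :=
  (∀ M ∈ F, IsMinNonFace K M) ∧
  ContractibleSpace (realization (K ∪ ↑F))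

/-- The simplicial boundary of a finite subset `σ = {v₀ < v₁ < ⋯ < v_n}` of `[m]`:
the element `Σᵢ (−1)ⁱ · (σ \ {vᵢ})` of the free `ℤ`-module on the finite subsets of `[m]`. -/
noncomputable def bdry {m : ℕ} (σ : Finset (Fin m)) : Finset (Fin m) →₀ ℤ :=
  ∑ v ∈ σ, ((-1 : ℤ) ^ (σ.filter (fun w => w < v)).card) • Finsupp.single (σ.erase v) 1


open Finsupp in
/-- A linear extension maps chains supported in `s` into any submodule containing the images of `s`. -/
theorem linearCombination_mem_of_supported {α M : Type*} [AddCommGroup M] {s : Set α}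
    {f : α → M} {p : Submodule ℤ M} (hf : ∀ a ∈ s, f a ∈ p) {c : α →₀ ℤ}
    (hc : c ∈ supported ℤ ℤ s) : linearCombination ℤ f c ∈ p := by
  rw [linearCombination_apply]
  exact Submodule.sum_mem p fun a ha => p.smul_mem _ (hf a ((mem_supported ℤ c).1 hc ha))

open Finsupp in
/-- Two linear extensions agree on chains supported where the underlying functions agree. -/
theorem linearCombination_congr_of_supported {α M : Type*} [AddCommGroup M] {s : Set α}
    {f g : α → M} (hfg : ∀ a ∈ s, f a = g a) {c : α →₀ ℤ}
    (hc : c ∈ supported ℤ ℤ s) : linearCombination ℤ f c = linearCombination ℤ g c := by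
  rw [linearCombination_apply, linearCombination_apply]
  exact Finsupp.sum_congr fun a ha => by rw [hfg a ((mem_supported ℤ c).1 hc ha)]

/-! ### Augmented ordered chains: the free module on lists of points -/

namespace ListChain

open Finsupp

variable {α β : Type*}

/-- Prepending a point to every list of a chain. -/
noncomputable def cons (x : α) : (List α →₀ ℤ) →ₗ[ℤ] (List α →₀ ℤ) :=
  lmapDomain ℤ ℤ (List.cons x)

@[simp] theorem cons_single (x : α) (l : List α) (z : ℤ) :
    cons x (single l z) = single (x :: l) z := by
  simp [cons]

/-- The ordered boundary of a list. -/
noncomputable def boundaryList : List α → (List α →₀ ℤ)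
  | [] => 0
  | x :: l => single l 1 - cons x (boundaryList l)

/-- The boundary map of the augmented ordered chain complex. -/
noncomputable def boundary : (List α →₀ ℤ) →ₗ[ℤ] (List α →₀ ℤ) :=
  linearCombination ℤ boundaryList

theorem boundary_cons (x : α) (c : List α →₀ ℤ) :
    boundary (cons x c) = c - cons x (boundary c) := by
  suffices h : boundary ∘ₗ cons x = LinearMap.id - cons x ∘ₗ boundary from
    LinearMap.congr_fun h c
  ext l : 2
  simp [boundary, boundaryList]

/-- The chain map induced by a map of points. -/
noncomputable def map (f : α → β) : (List α →₀ ℤ) →ₗ[ℤ] (List β →₀ ℤ) :=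
  lmapDomain ℤ ℤ (List.map f)

@[simp] theorem map_single (f : α → β) (l : List α) (z : ℤ) :
    map f (single l z) = single (l.map f) z := by
  simp [map]

theorem map_cons (f : α → β) (x : α) (c : List α →₀ ℤ) :
    map f (cons x c) = cons (f x) (map f c) := by
  suffices h : map f ∘ₗ cons x = cons (f x) ∘ₗ map f from LinearMap.congr_fun h c
  ext l : 2
  simp

theorem boundary_map (f : α → β) (c : List α →₀ ℤ) :
    boundary (map f c) = map f (boundary c) := by
  suffices h : boundary ∘ₗ map f = map f ∘ₗ boundary from LinearMap.congr_fun h c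
  ext l : 2
  simp only [LinearMap.comp_apply, lsingle_apply]
  induction l with
  | nil => simp [boundary, boundaryList]
  | cons x l ih =>
    rw [← cons_single, map_cons, boundary_cons, ih, boundary_cons, map_sub, map_cons]

/-- The prism over a list between its images under two maps. -/
noncomputable def prismList (f g : α → β) : List α → (List β →₀ ℤ)
  | [] => 0
  | x :: l => single (f x :: g x :: l.map g) 1 - cons (f x) (prismList f g l)

/-- The prism operator. -/
noncomputable def prism (f g : α → β) : (List α →₀ ℤ) →ₗ[ℤ] (List β →₀ ℤ) :=
  linearCombination ℤ (prismList f g)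

theorem prism_cons (f g : α → β) (x : α) (c : List α →₀ ℤ) :
    prism f g (cons x c) = cons (f x) (cons (g x) (map g c)) - cons (f x) (prism f g c) := by
  suffices h : prism f g ∘ₗ cons x =
      cons (f x) ∘ₗ cons (g x) ∘ₗ map g - cons (f x) ∘ₗ prism f g from LinearMap.congr_fun h c
  ext l : 2
  simp [prism, prismList]

theorem boundary_prism (f g : α → β) (c : List α →₀ ℤ) :
    boundary (prism f g c) = map g c - map f c - prism f g (boundary c) := by
  suffices h : boundary ∘ₗ prism f g = map g - map f - prism f g ∘ₗ boundary from
    LinearMap.congr_fun h c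
  ext l : 2
  simp only [LinearMap.comp_apply, lsingle_apply, LinearMap.sub_apply]
  induction l with
  | nil => simp [boundary, boundaryList, prism, prismList]
  | cons x l ih =>
    rw [← cons_single, prism_cons, map_sub, boundary_cons, boundary_cons, boundary_cons, ih,
      boundary_map, boundary_cons]
    simp only [map_sub, map_cons, prism_cons]
    abel

theorem prismList_mem (f g : α → β) (l : List α) :
    prismList f g l ∈ supported ℤ ℤ
      {l' : List β | l'.length = l.length + 1 ∧ ∀ y ∈ l', ∃ x ∈ l, y = f x ∨ y = g x} := by
  induction l with
  | nil => exact Submodule.zero_mem _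
  | cons x l ih =>
    refine Submodule.sub_mem _ (single_mem_supported ℤ _ ⟨by simp, ?_⟩) ?_
    · simp only [List.mem_cons, List.mem_map]
      rintro y (rfl | rfl | ⟨z, hz, rfl⟩)
      · exact ⟨x, .inl rfl, .inl rfl⟩
      · exact ⟨x, .inl rfl, .inr rfl⟩
      · exact ⟨z, .inr hz, .inr rfl⟩
    · have := linearCombination_mem_of_supported (f := fun l' => single (f x :: l') (1 : ℤ))
        (p := supported ℤ ℤ {l' : List β | l'.length = (x :: l).length + 1 ∧
          ∀ y ∈ l', ∃ z ∈ x :: l, y = f z ∨ y = g z}) ?_ ih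
      · convert this using 1
        suffices h : cons (f x) = linearCombination ℤ fun l' => single (f x :: l') (1 : ℤ) from
          LinearMap.congr_fun h _
        ext l' : 2
        simp
      · rintro l' ⟨hlen, hl'⟩
        refine single_mem_supported ℤ _ ⟨by simp [hlen], ?_⟩
        simp only [List.mem_cons]
        rintro y (rfl | hy)
        · exact ⟨x, .inl rfl, .inl rfl⟩
        · obtain ⟨z, hz, h⟩ := hl' y hy
          exact ⟨z, .inr hz, h⟩

/-- Lists of `k` points of `S` that are pairwise at distance less than `ε`. -/
def small [PseudoMetricSpace α] (ε : ℝ) (S : Set α) (k : ℕ) : Set (List α) :=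
  {l | l.length = k ∧ (∀ x ∈ l, x ∈ S) ∧ ∀ x ∈ l, ∀ y ∈ l, dist x y < ε}

theorem small_mono [PseudoMetricSpace α] {ε ε' : ℝ} {S S' : Set α} (hε : ε ≤ ε') (hS : S ⊆ S')
    (k : ℕ) : small ε S k ⊆ small ε' S' k := fun _ hl =>
  ⟨hl.1, fun x hx => hS (hl.2.1 x hx), fun x hx y hy => (hl.2.2 x hx y hy).trans_le hε⟩

/-- A contraction of `S` that is uniformly continuous in space and time. -/
theorem exists_uniform_contraction [PseudoMetricSpace α] {S : Set α} (hS : IsCompact S)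
    [ContractibleSpace S] :
    ∃ (p : α) (h : unitInterval → α → α), p ∈ S ∧ (∀ t, ∀ x ∈ S, h t x ∈ S) ∧
      (∀ x ∈ S, h 0 x = x) ∧ (∀ x ∈ S, h 1 x = p) ∧
      ∀ ε > 0, ∃ δ > 0, ∀ s t, ∀ x ∈ S, ∀ y ∈ S, dist s t < δ → dist x y < δ →
        dist (h s x) (h t y) < ε := by
  classical
  have : CompactSpace S := isCompact_iff_compactSpace.1 hS
  obtain ⟨p, ⟨H⟩⟩ := id_nullhomotopic S
  refine ⟨p, fun t x => if hx : x ∈ S then H (t, ⟨x, hx⟩) else x, p.2, ?_, ?_, ?_, ?_⟩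
  · intro t x hx
    simp [hx]
  · intro x hx
    simp [hx]
  · intro x hx
    simp [hx]
  · intro ε hε
    have huc := CompactSpace.uniformContinuous_of_continuous H.continuous
    obtain ⟨δ, hδ, hH⟩ := Metric.uniformContinuous_iff.1 huc ε hε
    refine ⟨δ, hδ, fun s t x hx y hy hst hxy => ?_⟩
    simp only [hx, hy, dif_pos]
    exact hH (a := (s, ⟨x, hx⟩)) (b := (t, ⟨y, hy⟩)) (max_lt hst hxy)

/-- In a compact contractible set, sufficiently small cycles bound small chains. -/
theorem exists_boundary_eq_of_contractible [PseudoMetricSpace α] {S : Set α} (hS : IsCompact S)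
    [ContractibleSpace S] {ε : ℝ} (hε : 0 < ε) :
    ∃ δ > 0, ∀ (k : ℕ), ∀ c ∈ supported ℤ ℤ (small δ S k), boundary c = 0 →
      ∃ w ∈ supported ℤ ℤ (small ε S (k + 1)), boundary w = c := by
  obtain ⟨p, h, hp, hmap, h0, h1, huc⟩ := exists_uniform_contraction hS
  obtain ⟨δ, hδ, hh⟩ := huc ε hε
  refine ⟨δ, hδ, fun k c hc hbc => ?_⟩
  obtain ⟨n, hn⟩ := exists_nat_one_div_lt hδ
  have hn0 : (0 : ℝ) < n + 1 := by positivity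
  let T : ℕ → unitInterval := fun i => Set.projIcc 0 1 zero_le_one ((i : ℝ) / (n + 1))
  have hT0 : T 0 = 0 := by simp [T]
  have hT1 : T (n + 1) = 1 := by
    have : ((n + 1 : ℕ) : ℝ) / (n + 1) = 1 := by push_cast; exact div_self hn0.ne'
    simp only [T, this]
    exact Set.projIcc_right (zero_le_one (α := ℝ))
  have hTd : ∀ i, dist (T i) (T (i + 1)) < δ := by
    intro i
    have h2 : dist (T i) (T (i + 1)) ≤ dist ((i : ℝ) / (n + 1)) (((i + 1 : ℕ) : ℝ) / (n + 1)) := by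
      simpa [T] using (LipschitzWith.projIcc (zero_le_one (α := ℝ))).dist_le_mul
        ((i : ℝ) / (n + 1)) (((i + 1 : ℕ) : ℝ) / (n + 1))
    refine h2.trans_lt (lt_of_eq_of_lt ?_ hn)
    rw [Real.dist_eq, ← sub_div, abs_div, abs_of_pos hn0]
    push_cast
    simp
  have hstart : map (h (T 0)) c = c := by
    have : linearCombination ℤ (fun l => single (l.map (h (T 0))) (1 : ℤ)) c
        = linearCombination ℤ (fun l => single l (1 : ℤ)) c := by
      refine linearCombination_congr_of_supported (fun l hl => ?_) hc
      congr 1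
      rw [hT0]
      exact (List.map_congr_left fun x hx => h0 x (hl.2.1 x hx)).trans (List.map_id _)
    have e1 : map (h (T 0)) = linearCombination ℤ (fun l => single (l.map (h (T 0))) (1 : ℤ)) := by
      ext l : 2
      simp
    have e2 : (LinearMap.id : (List α →₀ ℤ) →ₗ[ℤ] _) =
        linearCombination ℤ (fun l => single l (1 : ℤ)) := by
      ext l : 2
      simp
    rw [e1, this, ← e2, LinearMap.id_apply]
  have hend : cons p (map (h (T (n + 1))) c) ∈ supported ℤ ℤ (small ε S (k + 1)) := by
    have e : cons p ∘ₗ map (h (T (n + 1))) =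
        linearCombination ℤ (fun l => single (p :: l.map (h (T (n + 1)))) (1 : ℤ)) := by
      ext l : 2
      simp
    rw [← LinearMap.comp_apply, e]
    refine linearCombination_mem_of_supported (fun l hl => single_mem_supported ℤ _ ?_) hc
    have hall : ∀ x ∈ p :: l.map (h (T (n + 1))), x = p := by
      simp only [List.mem_cons, List.mem_map]
      rintro x (rfl | ⟨y, hy, rfl⟩)
      · rfl
      · rw [hT1, h1 y (hl.2.1 y hy)]
    refine ⟨by simp [hl.1], fun x hx => hall x hx ▸ hp, fun x hx y hy => ?_⟩
    rw [hall x hx, hall y hy, dist_self]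
    exact hε
  have hprism : ∀ i, prism (h (T i)) (h (T (i + 1))) c ∈ supported ℤ ℤ (small ε S (k + 1)) := by
    intro i
    refine linearCombination_mem_of_supported (fun l hl => ?_) hc
    refine supported_mono ?_ (prismList_mem _ _ l)
    rintro l' ⟨hlen, hl'⟩
    have hclose : ∀ s t, (s = T i ∨ s = T (i + 1)) → (t = T i ∨ t = T (i + 1)) →
        dist s t < δ := by
      rintro s t (rfl | rfl) (rfl | rfl)
      · simpa using hδ
      · exact hTd i
      · rw [dist_comm]; exact hTd i
      · simpa using hδ
    have hform : ∀ y ∈ l', ∃ x ∈ l, ∃ t, (t = T i ∨ t = T (i + 1)) ∧ y = h t x := by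
      intro y hy
      obtain ⟨x, hx, hxy | hxy⟩ := hl' y hy
      · exact ⟨x, hx, _, .inl rfl, hxy⟩
      · exact ⟨x, hx, _, .inr rfl, hxy⟩
    refine ⟨by rw [hlen, hl.1], fun y hy => ?_, fun y hy y' hy' => ?_⟩
    · obtain ⟨x, hx, t, -, rfl⟩ := hform y hy
      exact hmap t x (hl.2.1 x hx)
    · obtain ⟨x, hx, t, ht, rfl⟩ := hform y hy
      obtain ⟨x', hx', t', ht', rfl⟩ := hform y' hy'
      exact hh t t' x (hl.2.1 x hx) x' (hl.2.1 x' hx') (hclose t t' ht ht') (hl.2.2 x hx x' hx')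
  refine ⟨cons p (map (h (T (n + 1))) c) -
    ∑ i ∈ Finset.range (n + 1), prism (h (T i)) (h (T (i + 1))) c,
    Submodule.sub_mem _ hend (Submodule.sum_mem _ fun i _ => hprism i), ?_⟩
  rw [map_sub, map_sum, boundary_cons, boundary_map, hbc]
  simp only [boundary_prism, hbc, map_zero, sub_zero]
  rw [Finset.sum_range_sub (fun i => map (h (T i)) c), hstart]
  abel

end ListChain

/-! ### Augmented simplicial chains: the free module on finite subsets of `[m]` -/

namespace FinsetChain

open Finsupp

variable {m : ℕ}

/-- The linear extension of `bdry`. -/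
noncomputable def boundary : (Finset (Fin m) →₀ ℤ) →ₗ[ℤ] (Finset (Fin m) →₀ ℤ) :=
  linearCombination ℤ bdry

/-- The exterior product of a vertex with a finite set. -/
noncomputable def wedgeFinset (x : Fin m) (σ : Finset (Fin m)) : Finset (Fin m) →₀ ℤ :=
  if x ∈ σ then 0 else (-1 : ℤ) ^ (σ.filter (fun w => w < x)).card • single (insert x σ) 1

/-- Exterior multiplication by a vertex. -/
noncomputable def wedge (x : Fin m) : (Finset (Fin m) →₀ ℤ) →ₗ[ℤ] (Finset (Fin m) →₀ ℤ) :=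
  linearCombination ℤ (wedgeFinset x)

@[simp] theorem boundary_single (σ : Finset (Fin m)) : boundary (single σ 1) = bdry σ := by
  simp [boundary]

@[simp] theorem wedge_single (x : Fin m) (σ : Finset (Fin m)) :
    wedge x (single σ 1) = wedgeFinset x σ := by
  simp [wedge]

theorem wedge_sign {x v : Fin m} {σ : Finset (Fin m)} (hx : x ∉ σ) (hv : v ∈ σ) :
    (-1 : ℤ) ^ (σ.filter (fun w => w < x)).card *
        (-1) ^ ((insert x σ).filter (fun w => w < v)).card =
      -((-1) ^ (σ.filter (fun w => w < v)).card *
        (-1) ^ ((σ.erase v).filter (fun w => w < x)).card) := by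
  have hxv : x ≠ v := fun h => hx (h ▸ hv)
  rw [Finset.filter_insert, Finset.filter_erase]
  rcases lt_or_gt_of_ne hxv with h | h
  · rw [if_pos h, Finset.card_insert_of_notMem (by simp [hx]),
      Finset.erase_eq_of_notMem (by simp [h.le])]
    ring
  · rw [if_neg h.not_gt]
    have hmem : v ∈ σ.filter (fun w => w < x) := by simp [hv, h]
    rw [← Finset.card_erase_add_one hmem]
    ring

theorem boundary_wedge (x : Fin m) (c : Finset (Fin m) →₀ ℤ) :
    boundary (wedge x c) = c - wedge x (boundary c) := by
  suffices h : boundary ∘ₗ wedge x = LinearMap.id - wedge x ∘ₗ boundary from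
    LinearMap.congr_fun h c
  ext σ : 2
  simp only [LinearMap.comp_apply, lsingle_apply, LinearMap.sub_apply, LinearMap.id_apply,
    wedge_single, boundary_single]
  rw [bdry, map_sum]
  simp only [map_smul, wedge_single]
  by_cases hx : x ∈ σ
  · rw [wedgeFinset, if_pos hx, map_zero, Finset.sum_eq_single_of_mem x hx]
    · rw [wedgeFinset, if_neg (by simp), Finset.insert_erase hx, Finset.filter_erase,
        Finset.erase_eq_of_notMem (by simp), smul_smul, ← mul_pow]
      simp
    · intro v _ hvx
      rw [wedgeFinset, if_pos (Finset.mem_erase.2 ⟨hvx.symm, hx⟩), smul_zero]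
  · rw [wedgeFinset, if_neg hx, map_smul, boundary_single, bdry, Finset.sum_insert hx,
      Finset.erase_insert hx, Finset.filter_insert, if_neg (lt_irrefl x), smul_add, smul_smul,
      ← mul_pow, sub_eq_add_neg, ← Finset.sum_neg_distrib, Finset.smul_sum]
    congr 1
    · simp
    · refine Finset.sum_congr rfl fun v hv => ?_
      have hxv : x ≠ v := fun h => hx (h ▸ hv)
      rw [wedgeFinset, if_neg (by simp [hx]), smul_smul, smul_smul, wedge_sign hx hv, neg_smul,
        Finset.erase_insert_of_ne hxv]

theorem boundary_bdry (σ : Finset (Fin m)) : boundary (bdry σ) = 0 := by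
  induction σ using Finset.induction_on with
  | empty => simp [bdry]
  | insert x σ hx ih =>
    have h : single (insert x σ) (1 : ℤ) =
        (-1 : ℤ) ^ (σ.filter (fun w => w < x)).card • wedge x (single σ 1) := by
      rw [wedge_single, wedgeFinset, if_neg hx, smul_smul, ← mul_pow]
      simp
    rw [← boundary_single, h, map_smul, map_smul, boundary_wedge, map_sub, boundary_wedge,
      boundary_single, ih, map_zero, sub_zero, sub_self, smul_zero]

theorem bdry_mem (σ : Finset (Fin m)) :
    bdry σ ∈ supported ℤ ℤ {τ : Finset (Fin m) | ∃ v ∈ σ, τ = σ.erase v} :=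
  Submodule.sum_mem _ fun v hv =>
    Submodule.smul_mem _ _ (single_mem_supported ℤ _ ⟨v, hv, rfl⟩)

/-- A chain on subsets of `σ` of full size is determined by its boundary. -/
theorem eq_zero_of_boundary_eq_zero {σ : Finset (Fin m)} (hσ : σ.Nonempty)
    {c : Finset (Fin m) →₀ ℤ} (hc : c ∈ supported ℤ ℤ {σ}) (hbc : boundary c = 0) : c = 0 := by
  obtain ⟨x, hx⟩ := hσ
  have hw : wedge x c = 0 := by
    have := linearCombination_mem_of_supported (f := wedgeFinset x) (p := ⊥) ?_ hc
    · exact this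
    · rintro _ rfl
      simp [wedgeFinset, hx]
  have := boundary_wedge x c
  rw [hw, hbc, map_zero, map_zero, sub_zero] at this
  exact this.symm

variable {α : Type*}

/-- The oriented simplex spanned by the images of a list of points under a vertex map. -/
noncomputable def ofList (φ : α → Fin m) : List α → (Finset (Fin m) →₀ ℤ)
  | [] => single ∅ 1
  | x :: l => wedge (φ x) (ofList φ l)

/-- The chain map from ordered chains to simplicial chains induced by a vertex map. -/
noncomputable def ofListChain (φ : α → Fin m) : (List α →₀ ℤ) →ₗ[ℤ] (Finset (Fin m) →₀ ℤ) :=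
  linearCombination ℤ (ofList φ)

theorem ofListChain_cons (φ : α → Fin m) (x : α) (c : List α →₀ ℤ) :
    ofListChain φ (ListChain.cons x c) = wedge (φ x) (ofListChain φ c) := by
  suffices h : ofListChain φ ∘ₗ ListChain.cons x = wedge (φ x) ∘ₗ ofListChain φ from
    LinearMap.congr_fun h c
  ext l : 2
  simp [ofListChain, ofList]

theorem boundary_ofListChain (φ : α → Fin m) (c : List α →₀ ℤ) :
    boundary (ofListChain φ c) = ofListChain φ (ListChain.boundary c) := by
  suffices h : boundary ∘ₗ ofListChain φ = ofListChain φ ∘ₗ ListChain.boundary from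
    LinearMap.congr_fun h c
  ext l : 2
  simp only [LinearMap.comp_apply, lsingle_apply]
  induction l with
  | nil => simp [ofListChain, ofList, ListChain.boundary, ListChain.boundaryList, bdry]
  | cons x l ih =>
    rw [← ListChain.cons_single, ofListChain_cons, boundary_wedge, ih, ListChain.boundary_cons,
      map_sub, ofListChain_cons]

theorem ofList_mem (φ : α → Fin m) (l : List α) :
    ofList φ l ∈ supported ℤ ℤ
      {τ : Finset (Fin m) | τ.card = l.length ∧ ∀ v ∈ τ, ∃ x ∈ l, φ x = v} := by
  induction l with
  | nil => exact single_mem_supported ℤ _ (by simp)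
  | cons x l ih =>
    refine linearCombination_mem_of_supported ?_ ih
    rintro τ ⟨hcard, hτ⟩
    unfold wedgeFinset
    split_ifs with hx
    · exact Submodule.zero_mem _
    · refine Submodule.smul_mem _ _ (single_mem_supported ℤ _ ⟨?_, ?_⟩)
      · rw [Finset.card_insert_of_notMem hx, hcard, List.length_cons]
      · intro v hv
        rcases Finset.mem_insert.1 hv with rfl | hv
        · exact ⟨x, by simp, rfl⟩
        · obtain ⟨y, hy, h⟩ := hτ v hv
          exact ⟨y, by simp [hy], h⟩

end FinsetChain

/-! ### Geometry of the realization -/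

section Geometry

open Finsupp

variable {m : ℕ}

/-- The closed geometric simplex spanned by the vertices in `σ`. -/
def geomSimplex (σ : Finset (Fin m)) : Set (Fin m → ℝ) :=
  convexHull ℝ (stdBasisVec m '' (σ : Set (Fin m)))

theorem isCompact_geomSimplex (σ : Finset (Fin m)) : IsCompact (geomSimplex σ) :=
  (σ.finite_toSet.image _).isCompact_convexHull ℝ

theorem contractibleSpace_geomSimplex {σ : Finset (Fin m)} (hσ : σ.Nonempty) :
    ContractibleSpace (geomSimplex σ) :=
  (convex_convexHull ℝ _).contractibleSpace ((hσ.to_set.image _).convexHull)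

theorem geomSimplex_mono {σ τ : Finset (Fin m)} (h : σ ⊆ τ) : geomSimplex σ ⊆ geomSimplex τ :=
  convexHull_mono (Set.image_mono (Finset.coe_subset.2 h))

theorem isCompact_realization (K : Set (Finset (Fin m))) : IsCompact (realization K) :=
  (Set.toFinite K).isCompact_biUnion fun σ _ => isCompact_geomSimplex σ

theorem geomSimplex_subset (σ : Finset (Fin m)) :
    geomSimplex σ ⊆ {x | ∑ i, x i = 1 ∧ ∀ i ∉ σ, x i = 0} := by
  refine convexHull_min ?_ ?_
  · rintro _ ⟨v, hv, rfl⟩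
    refine ⟨by simp [stdBasisVec], fun i hi => ?_⟩
    rw [stdBasisVec, if_neg]
    rintro rfl
    exact hi hv
  · rintro x ⟨hx, hx'⟩ y ⟨hy, hy'⟩ a b _ _ hab
    refine ⟨?_, fun i hi => by simp [hx' i hi, hy' i hi]⟩
    simp [Finset.sum_add_distrib, ← Finset.mul_sum, hx, hy, hab]

/-- A point of a simplex has a barycentric coordinate that is at least the average. -/
theorem exists_large_coordinate (x : Fin m → ℝ) (hx : ∑ i, x i = 1) :
    ∃ v, 1 / (m : ℝ) ≤ x v := by
  by_contra! h
  have hm : Nonempty (Fin m) := by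
    by_contra hm
    rw [not_nonempty_iff] at hm
    simp at hx
  have hlt := Finset.sum_lt_sum_of_nonempty Finset.univ_nonempty fun i _ => h i
  have hpos : (m : ℝ) ≠ 0 := by
    have := Fin.pos_iff_nonempty.2 hm
    positivity
  rw [hx] at hlt
  simp [hpos] at hlt

/-- Arbitrarily fine ordered chains subdividing the simplices on `[m]`. -/
theorem exists_fine_subdivision (d : ℕ) {ε : ℝ} (hε : 0 < ε) :
    ∃ f : Finset (Fin m) → (List (Fin m → ℝ) →₀ ℤ), f ∅ = single [] 1 ∧
      ∀ σ, σ.card ≤ d → f σ ∈ supported ℤ ℤ (ListChain.small ε (geomSimplex σ) σ.card) ∧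
        ListChain.boundary (f σ) = linearCombination ℤ f (bdry σ) := by
  classical
  induction d generalizing ε with
  | zero =>
    refine ⟨fun _ => single [] 1, rfl, fun σ hσ => ?_⟩
    obtain rfl : σ = ∅ := by simpa using hσ
    exact ⟨single_mem_supported ℤ _ (by simp [ListChain.small]),
      by simp [ListChain.boundary, ListChain.boundaryList, bdry]⟩
  | succ d ih =>
    have hfill : ∀ σ : Finset (Fin m), ∃ δ > 0, σ.Nonempty →
        ∀ (k : ℕ), ∀ c ∈ supported ℤ ℤ (ListChain.small δ (geomSimplex σ) k),
        ListChain.boundary c = 0 →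
        ∃ w ∈ supported ℤ ℤ (ListChain.small ε (geomSimplex σ) (k + 1)),
          ListChain.boundary w = c := by
      intro σ
      by_cases hσ : σ.Nonempty
      · have := contractibleSpace_geomSimplex hσ
        obtain ⟨δ, hδ, h⟩ :=
          ListChain.exists_boundary_eq_of_contractible (isCompact_geomSimplex σ) hε
        exact ⟨δ, hδ, fun _ => h⟩
      · exact ⟨1, one_pos, fun h => absurd h hσ⟩
    choose δ hδ hfill using hfill
    let δ₀ := min ε (Finset.univ.inf' Finset.univ_nonempty δ)
    have hδ₀ : 0 < δ₀ := lt_min hε ((Finset.lt_inf'_iff _).2 fun σ _ => hδ σ)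
    have hδ₀le : ∀ σ, δ₀ ≤ δ σ := fun σ =>
      (min_le_right _ _).trans (Finset.inf'_le _ (Finset.mem_univ σ))
    obtain ⟨f, hf0, hf⟩ := ih hδ₀
    have hfaces : ∀ σ : Finset (Fin m), σ.card = d + 1 → ∀ τ ∈
        {τ : Finset (Fin m) | ∃ v ∈ σ, τ = σ.erase v}, τ.card = d ∧ τ ⊆ σ := by
      rintro σ hσ _ ⟨v, hv, rfl⟩
      exact ⟨by rw [Finset.card_erase_of_mem hv, hσ, Nat.add_sub_cancel], Finset.erase_subset _ _⟩
    have hex : ∀ σ : Finset (Fin m), ∃ w, σ.card = d + 1 →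
        w ∈ supported ℤ ℤ (ListChain.small ε (geomSimplex σ) (d + 1)) ∧
          ListChain.boundary w = linearCombination ℤ f (bdry σ) := by
      intro σ
      by_cases hσ : σ.card = d + 1
      · have hmem : linearCombination ℤ f (bdry σ) ∈
            supported ℤ ℤ (ListChain.small (δ σ) (geomSimplex σ) d) := by
          refine linearCombination_mem_of_supported (fun τ hτ => ?_) (FinsetChain.bdry_mem σ)
          obtain ⟨hcard, hsub⟩ := hfaces σ hσ τ hτ
          have := (hf τ hcard.le).1
          rw [hcard] at this
          exact supported_mono
            (ListChain.small_mono (hδ₀le σ) (geomSimplex_mono hsub) d) this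
        have hcyc : ListChain.boundary (linearCombination ℤ f (bdry σ)) = 0 := by
          have e : ListChain.boundary (linearCombination ℤ f (bdry σ)) =
              linearCombination ℤ (fun τ => linearCombination ℤ f (bdry τ)) (bdry σ) := by
            rw [← LinearMap.comp_apply, ← Finsupp.linearCombination_linear_comp]
            exact linearCombination_congr_of_supported
              (fun τ hτ => (hf τ (hfaces σ hσ τ hτ).1.le).2) (FinsetChain.bdry_mem σ)
          have e' : linearCombination ℤ (fun τ => linearCombination ℤ f (bdry τ)) =
              linearCombination ℤ f ∘ₗ FinsetChain.boundary := by
            ext τ : 2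
            simp
          rw [e, e', LinearMap.comp_apply, FinsetChain.boundary_bdry, map_zero]
        obtain ⟨w, hw, hbw⟩ := hfill σ (Finset.card_pos.1 (by omega)) d _ hmem hcyc
        exact ⟨w, fun _ => ⟨hw, hbw⟩⟩
      · exact ⟨0, fun h => absurd h hσ⟩
    choose w hw using hex
    refine ⟨fun σ => if σ.card = d + 1 then w σ else f σ, by simp [hf0], fun σ hσ => ?_⟩
    have hcongr : linearCombination ℤ (fun σ => if σ.card = d + 1 then w σ else f σ) (bdry σ) =
        linearCombination ℤ f (bdry σ) := by
      refine linearCombination_congr_of_supported ?_ (FinsetChain.bdry_mem σ)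
      rintro _ ⟨v, hv, rfl⟩
      have := Finset.card_erase_lt_of_mem hv
      exact if_neg (by omega)
    rw [hcongr]
    by_cases hσ' : σ.card = d + 1
    · simp only [hσ', if_true]
      exact hw σ hσ'
    · simp only [hσ', if_false]
      obtain ⟨h1, h2⟩ := hf σ (by omega)
      exact ⟨supported_mono (ListChain.small_mono (min_le_left _ _) subset_rfl _) h1, h2⟩

/-- A vertex map retracts a subdivision of the simplices onto the identity. -/
theorem ofListChain_subdivision {d : ℕ} {ε : ℝ} {φ : (Fin m → ℝ) → Fin m}
    (hφ : ∀ σ, ∀ x ∈ geomSimplex σ, φ x ∈ σ)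
    {f : Finset (Fin m) → (List (Fin m → ℝ) →₀ ℤ)} (hf0 : f ∅ = single [] 1)
    (hf : ∀ σ, σ.card ≤ d →
      f σ ∈ supported ℤ ℤ (ListChain.small ε (geomSimplex σ) σ.card) ∧
        ListChain.boundary (f σ) = linearCombination ℤ f (bdry σ))
    (σ : Finset (Fin m)) (hσ : σ.card ≤ d) :
    FinsetChain.ofListChain φ (f σ) = single σ 1 := by
  induction σ using Finset.strongInduction with
  | H σ ih =>
    rcases σ.eq_empty_or_nonempty with rfl | hne
    · simp [hf0, FinsetChain.ofListChain, FinsetChain.ofList]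
    · have hmem : FinsetChain.ofListChain φ (f σ) ∈ supported ℤ ℤ {σ} := by
        refine linearCombination_mem_of_supported (fun l hl => ?_) (hf σ hσ).1
        refine supported_mono ?_ (FinsetChain.ofList_mem φ l)
        rintro τ ⟨hcard, hτ⟩
        refine Finset.eq_of_subset_of_card_le (fun v hv => ?_) (by rw [hcard, hl.1])
        obtain ⟨x, hx, rfl⟩ := hτ v hv
        exact hφ σ x (hl.2.1 x hx)
      rw [← sub_eq_zero]
      refine FinsetChain.eq_zero_of_boundary_eq_zero hne
        (Submodule.sub_mem _ hmem (single_mem_supported ℤ _ rfl)) ?_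
      rw [map_sub, FinsetChain.boundary_ofListChain, (hf σ hσ).2, FinsetChain.boundary_single,
        sub_eq_zero, ← LinearMap.comp_apply, ← Finsupp.linearCombination_linear_comp]
      have e : bdry σ = linearCombination ℤ (fun τ => single τ (1 : ℤ)) (bdry σ) := by
        have h : (LinearMap.id : (Finset (Fin m) →₀ ℤ) →ₗ[ℤ] _) =
            linearCombination ℤ fun τ => single τ (1 : ℤ) := by
          ext τ : 2
          simp
        rw [← h, LinearMap.id_apply]
      conv_rhs => rw [e]
      refine linearCombination_congr_of_supported ?_ (FinsetChain.bdry_mem σ)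
      rintro _ ⟨v, hv, rfl⟩
      exact ih _ (Finset.erase_ssubset hv) ((Finset.card_le_card (Finset.erase_subset _ _)).trans hσ)

/-- If a complex has contractible realization, every simplicial cycle on it bounds. -/
theorem exists_boundary_eq_of_contractible_realization {L : Set (Finset (Fin m))}
    (hL : ∀ σ ∈ L, ∀ τ : Finset (Fin m), τ ⊆ σ → τ.Nonempty → τ ∈ L)
    [ContractibleSpace (realization L)] {k : ℕ} {z : Finset (Fin m) →₀ ℤ}
    (hz : z ∈ supported ℤ ℤ {σ | σ ∈ L ∧ σ.card = k}) (hbz : FinsetChain.boundary z = 0) :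
    ∃ w ∈ supported ℤ ℤ {σ | σ ∈ L ∧ σ.card = k + 1}, FinsetChain.boundary w = z := by
  classical
  obtain ⟨⟨p, hp⟩⟩ : Nonempty (realization L) := inferInstance
  obtain ⟨σ₀, -, hpσ₀⟩ := Set.mem_iUnion₂.1 hp
  obtain ⟨v₀, -⟩ := exists_large_coordinate p (geomSimplex_subset σ₀ hpσ₀).1
  have hm : (0 : ℝ) < 1 / m := by
    have := v₀.pos
    positivity
  let φ : (Fin m → ℝ) → Fin m := fun x =>
    if hx : ∑ i, x i = 1 then (exists_large_coordinate x hx).choose else v₀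
  have hφlarge : ∀ σ, ∀ x ∈ geomSimplex σ, 1 / (m : ℝ) ≤ x (φ x) := by
    intro σ x hx
    have hsum := (geomSimplex_subset σ hx).1
    simp only [φ, dif_pos hsum]
    exact (exists_large_coordinate x hsum).choose_spec
  have hφ : ∀ σ, ∀ x ∈ geomSimplex σ, φ x ∈ σ := by
    intro σ x hx
    by_contra hnot
    have := hφlarge σ x hx
    rw [(geomSimplex_subset σ hx).2 _ hnot] at this
    exact absurd hm this.not_gt
  obtain ⟨δ, hδ, hfill⟩ :=
    ListChain.exists_boundary_eq_of_contractible (isCompact_realization L) hm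
  obtain ⟨f, hf0, hf⟩ := exists_fine_subdivision (m := m) k hδ
  have hmem : linearCombination ℤ f z ∈ supported ℤ ℤ (ListChain.small δ (realization L) k) := by
    refine linearCombination_mem_of_supported (fun σ hσ => ?_) hz
    have := (hf σ hσ.2.le).1
    rw [hσ.2] at this
    exact supported_mono (ListChain.small_mono le_rfl
      (Set.subset_biUnion_of_mem (u := fun σ => geomSimplex σ) hσ.1) k) this
  have hcyc : ListChain.boundary (linearCombination ℤ f z) = 0 := by
    rw [← LinearMap.comp_apply, ← Finsupp.linearCombination_linear_comp]
    calc _ = linearCombination ℤ (fun τ => linearCombination ℤ f (bdry τ)) z :=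
          linearCombination_congr_of_supported (fun σ hσ => (hf σ hσ.2.le).2) hz
      _ = (linearCombination ℤ f ∘ₗ FinsetChain.boundary) z := by
          congr 1
          ext τ : 2
          simp
      _ = 0 := by rw [LinearMap.comp_apply, hbz, map_zero]
  obtain ⟨w, hw, hbw⟩ := hfill k _ hmem hcyc
  refine ⟨FinsetChain.ofListChain φ w, ?_, ?_⟩
  · refine linearCombination_mem_of_supported (fun l hl => ?_) hw
    refine supported_mono ?_ (FinsetChain.ofList_mem φ l)
    rintro τ ⟨hcard, hτ⟩
    rw [hl.1] at hcard
    refine ⟨?_, hcard⟩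
    have hτne : τ.Nonempty := Finset.card_pos.1 (by omega)
    obtain ⟨x, hx⟩ : ∃ x, x ∈ l :=
      List.exists_mem_of_length_pos (by rw [hl.1]; omega)
    obtain ⟨σ, hσL, hxσ⟩ := Set.mem_iUnion₂.1 (hl.2.1 x hx)
    refine hL σ hσL τ (fun v hv => ?_) hτne
    obtain ⟨y, hy, rfl⟩ := hτ v hv
    obtain ⟨σ', -, hyσ'⟩ := Set.mem_iUnion₂.1 (hl.2.1 y hy)
    by_contra hnot
    have h1 := hφlarge σ' y hyσ'
    have h2 := (dist_le_pi_dist y x (φ y)).trans_lt (hl.2.2 y hy x hx)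
    rw [(geomSimplex_subset σ hxσ).2 _ hnot, Real.dist_eq, sub_zero] at h2
    exact absurd (h1.trans (le_abs_self _)) h2.not_ge
  · rw [FinsetChain.boundary_ofListChain, hbw, ← LinearMap.comp_apply,
      ← Finsupp.linearCombination_linear_comp]
    have h : (LinearMap.id : (Finset (Fin m) →₀ ℤ) →ₗ[ℤ] _) =
        linearCombination ℤ fun τ => single τ (1 : ℤ) := by
      ext τ : 2
      simp
    calc _ = linearCombination ℤ (fun τ => single τ (1 : ℤ)) z :=
          linearCombination_congr_of_supported
            (fun σ hσ => ofListChain_subdivision hφ hf0 hf σ hσ.2.le) hz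
      _ = z := by rw [← h, LinearMap.id_apply]

end Geometry

/-- Given two pure fillings `{M₁, …, M_r}` and `{N₁, …, N_r}` of `K` all of whose
members have cardinality `n + 1`, each `∂Nᵢ` is a `ℤ`-linear combination of the `∂Mⱼ`
up to the boundary of a `ℤ`-linear combination of `(n+1)`-element faces of `K`. -/
theorem pure_fillings_boundary_relation {m n r : ℕ} (K : Set (Finset (Fin m)))
    (hK : IsComplex K) (M N : Fin r → Finset (Fin m))
    (hMinj : Function.Injective M) (hNinj : Function.Injective N)
    (hMfill : IsFilling K (Finset.image M Finset.univ))
    (hNfill : IsFilling K (Finset.image N Finset.univ))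
    (hMcard : ∀ i, (M i).card = n + 1) (hNcard : ∀ i, (N i).card = n + 1) :
    ∀ i : Fin r, ∃ (a : Fin r → ℤ) (c : Finset (Fin m) →₀ ℤ),
      (∀ σ ∈ c.support, σ ∈ K ∧ σ.card = n + 1) ∧
      bdry (N i) = (∑ j, a j • bdry (M j)) + c.sum (fun σ z => z • bdry σ) := by
  classical
  intro i
  obtain ⟨hMmin, hMcontr⟩ := hMfill
  have hL : ∀ σ ∈ K ∪ ↑(Finset.image M Finset.univ), ∀ τ : Finset (Fin m), τ ⊆ σ →
      τ.Nonempty → τ ∈ K ∪ ↑(Finset.image M Finset.univ) := by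
    rintro σ (hσ | hσ) τ hτ hne
    · exact .inl (hK.2.1 σ hσ τ hτ hne)
    · rcases hτ.eq_or_ssubset with rfl | hss
      · exact .inr hσ
      · obtain ⟨v, hv, hvτ⟩ := Finset.exists_of_ssubset hss
        exact .inl (hK.2.1 _ ((hMmin σ (Finset.mem_coe.1 hσ)).2.2 v hv) τ
          (Finset.subset_erase.2 ⟨hτ, hvτ⟩) hne)
  obtain ⟨w, hw, hbw⟩ := exists_boundary_eq_of_contractible_realization hL (k := n)
    (z := bdry (N i)) (Finsupp.supported_mono (by
      rintro _ ⟨v, hv, rfl⟩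
      refine ⟨.inl ((hNfill.1 (N i) (by simp)).2.2 v hv), ?_⟩
      rw [Finset.card_erase_of_mem hv, hNcard, Nat.add_sub_cancel]) (FinsetChain.bdry_mem (N i)))
    (FinsetChain.boundary_bdry _)
  have hwmem := (Finsupp.mem_supported ℤ w).1 hw
  refine ⟨fun j => w (M j), w.filter (· ∈ K), fun σ hσ => ?_, ?_⟩
  · rw [Finsupp.support_filter, Finset.mem_filter] at hσ
    exact ⟨hσ.2, (hwmem (Finset.mem_coe.2 hσ.1)).2⟩
  · have hM : ∀ j, M j ∉ K := fun j => (hMmin (M j) (by simp)).2.1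
    have hnonface : w.filter (· ∉ K) = ∑ j, Finsupp.single (M j) (w (M j)) := by
      ext σ
      rw [Finsupp.filter_apply, Finsupp.finsetSum_apply, ite_not]
      by_cases hσ : ∃ j, M j = σ
      · obtain ⟨j, rfl⟩ := hσ
        rw [if_neg (hM j), Finset.sum_eq_single_of_mem j (Finset.mem_univ j)]
        · simp
        · intro j' _ hj'
          exact Finsupp.single_eq_of_ne (hMinj.ne hj'.symm)
      · rw [Finset.sum_eq_zero fun j _ =>
          Finsupp.single_eq_of_ne fun h => hσ ⟨j, h.symm⟩]
        split_ifs with hσK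
        · rfl
        · by_contra hne
          rcases (hwmem (Finsupp.mem_support_iff.2 hne)).1 with h | h
          · exact hσK h
          · exact hσ (by simpa using h)
    have hsplit : bdry (N i) = FinsetChain.boundary (∑ j, Finsupp.single (M j) (w (M j))) +
        FinsetChain.boundary (w.filter (· ∈ K)) := by
      rw [← hnonface, ← map_add, add_comm, Finsupp.filter_add_filter_not, hbw]
    rw [hsplit]
    congr 1
    simp [FinsetChain.boundary]
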